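/- arXiv:1805.11679 — 2 statements merged into one kernel-verified Lean document; each statement's English description precedes it below -/
import Mathlib

section
/- If Y ⊆ ℝ² is a discrete set such that for some ε > 0 and all sufficiently large r, the number of points of Y in the open ball of radius r about the origin is less than r / (log r)^(1+ε), then the sum over y ∈ Y \ {0} of 1/‖y‖ converges. -/
open Metric Set MeasureTheory Filter Real

noncomputable def setDist {E : Type*} [PseudoMetricSpace E] (A B : Set E) : ℝ :=
  sInf (Set.image2 dist A B)

def ray {E : Type*} [NormedAddCommGroup E] [NormedSpace ℝ E] (x v : E) : Set E :=
  {p : E | ∃ t : ℝ, 0 ≤ t ∧ p = x + t • v}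

/-- A nonnegative function on a type partitioned by `n : α → ℕ` is summable if the fibres are
finite and, eventually, the fibre over `k` has at most `c k` elements, each of value at most `b k`,
where `c * b` is summable. -/
theorem summable_of_fiber_card_mul_le {α : Type*} {f : α → ℝ} (hf : 0 ≤ f) (n : α → ℕ)
    (hfin : ∀ k, (n ⁻¹' {k}).Finite) {c b : ℕ → ℝ} (hcb : Summable fun k => c k * b k)
    {K : ℕ} (hb : ∀ k ≥ K, 0 ≤ b k) (hcard : ∀ k ≥ K, ((n ⁻¹' {k}).ncard : ℝ) ≤ c k)
    (hval : ∀ a, K ≤ n a → f a ≤ b (n a)) : Summable f := by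
  rw [summable_partition hf (s := fun k => n ⁻¹' {k}) fun a => ⟨n a, rfl, fun _ h => h.symm⟩]
  have hfinite (k : ℕ) : Finite (n ⁻¹' {k}) := hfin k
  refine ⟨fun k => Summable.of_finite, ?_⟩
  refine hcb.of_norm_bounded_eventually_nat ?_
  filter_upwards [eventually_ge_atTop K] with k hk
  rw [Real.norm_of_nonneg (tsum_nonneg fun a : n ⁻¹' {k} => hf a)]
  have := Fintype.ofFinite (n ⁻¹' {k})
  rw [tsum_fintype]
  calc ∑ a : n ⁻¹' {k}, f a ≤ ∑ _a : n ⁻¹' {k}, b k :=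
        Finset.sum_le_sum fun a _ => by
          have ha : n a = k := a.2
          simpa only [ha] using hval a (hk.trans_eq ha.symm)
    _ = (n ⁻¹' {k}).ncard * b k := by
        rw [Finset.sum_const, nsmul_eq_mul, Finset.card_univ, ← Nat.card_eq_fintype_card,
          Nat.card_coe_set_eq]
    _ ≤ c k * b k := mul_le_mul_of_nonneg_right (hcard k hk) (hb k hk)

theorem lt_two_pow_floor_logb_add_one {x : ℝ} (hx : 0 < x) :
    x < 2 ^ (⌊Real.logb 2 x⌋₊ + 1) := by
  have h := (Real.logb_lt_iff_lt_rpow one_lt_two hx).1 (Nat.lt_floor_add_one (Real.logb 2 x))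
  exact_mod_cast h

theorem two_pow_floor_logb_le {x : ℝ} (hx : 0 < x) (h : 1 ≤ ⌊Real.logb 2 x⌋₊) :
    2 ^ ⌊Real.logb 2 x⌋₊ ≤ x := by
  have hlog : 0 ≤ Real.logb 2 x := zero_le_one.trans (Nat.floor_pos.1 h)
  have h := (Real.le_logb_iff_rpow_le one_lt_two hx).1 (Nat.floor_le hlog)
  exact_mod_cast h

theorem summable_two_pow_div_log_rpow {p : ℝ} (hp : 1 < p) :
    Summable fun k : ℕ =>
      (2 : ℝ) ^ (k + 1) / Real.log (2 ^ (k + 1)) ^ p * (1 / 2 ^ k) := by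
  have h := (((summable_nat_add_iff 1).2 (Real.summable_nat_rpow_inv.2 hp)).mul_left
    (2 / Real.log 2 ^ p))
  refine h.congr fun k => ?_
  rw [Real.log_pow, Real.mul_rpow (by positivity) (Real.log_nonneg one_le_two)]
  have : (0 : ℝ) < Real.log 2 ^ p := Real.rpow_pos_of_pos (Real.log_pos one_lt_two) p
  have : (0 : ℝ) < ((k + 1 : ℕ) : ℝ) ^ p := by positivity
  field_simp
  ring

theorem stmt0 (Y : Set (EuclideanSpace ℝ (Fin 2)))
    (hdisc : ∀ (x : EuclideanSpace ℝ (Fin 2)) (r : ℝ), (Y ∩ Metric.ball x r).Finite)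
    (hgrowth : ∃ ε > (0 : ℝ), ∃ r₀ : ℝ, ∀ r ≥ r₀,
      ((Y ∩ Metric.ball (0 : EuclideanSpace ℝ (Fin 2)) r).ncard : ℝ) <
        r / (Real.log r) ^ (1 + ε)) :
    Summable (fun y : ↥(Y \ {0}) => 1 / ‖(y : EuclideanSpace ℝ (Fin 2))‖) := by
  obtain ⟨ε, hε, r₀, hr₀⟩ := hgrowth
  obtain ⟨K, hK⟩ := pow_unbounded_of_one_lt r₀ (one_lt_two (α := ℝ))
  let n : ↥(Y \ {0}) → ℕ := fun y => ⌊Real.logb 2 ‖(y : EuclideanSpace ℝ (Fin 2))‖⌋₊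
  have hpos (y : ↥(Y \ {0})) : 0 < ‖(y : EuclideanSpace ℝ (Fin 2))‖ := norm_pos_iff.2 y.2.2
  have hmaps (k : ℕ) : Subtype.val '' (n ⁻¹' {k}) ⊆ Y ∩ Metric.ball 0 (2 ^ (k + 1)) := by
    rintro _ ⟨y, rfl, rfl⟩
    exact ⟨y.2.1, mem_ball_zero_iff.2 (lt_two_pow_floor_logb_add_one (hpos y))⟩
  refine summable_of_fiber_card_mul_le (fun y => by positivity) n (K := K + 1)
    (fun k => Set.Finite.of_finite_image ((hdisc 0 _).subset (hmaps k))
      Subtype.val_injective.injOn)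
    (summable_two_pow_div_log_rpow (p := 1 + ε) (by linarith))
    (fun k _ => by positivity) (fun k hk => ?_) (fun y hy => ?_)
  · have hle : (n ⁻¹' {k}).ncard ≤ (Y ∩ Metric.ball 0 (2 ^ (k + 1))).ncard := by
      rw [← Set.ncard_image_of_injective _ Subtype.val_injective]
      exact Set.ncard_le_ncard (hmaps k) (hdisc 0 _)
    have hr : r₀ ≤ 2 ^ (k + 1) :=
      hK.le.trans (pow_le_pow_right₀ one_le_two (by omega))
    exact (Nat.cast_le.2 hle).trans (hr₀ _ hr).le
  · exact one_div_le_one_div_of_le (by positivity)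
      (two_pow_floor_logb_le (hpos y) (le_trans (by omega) hy))
end

section
/- There exists a uniformly separated set Y ⊆ ℝ² such that no point of ℝ² is visible for Y (i.e., every ray in ℝ² comes arbitrarily close to Y) and lim_{r→∞} G_Y(r)·(log r)/r = 1. -/
open Metric Set MeasureTheory Filter Real

/-- The point with coordinates `(a, h)` in the orthonormal frame rotated by the angle `θ`. -/
noncomputable def framePoint (θ a h : ℝ) : EuclideanSpace ℝ (Fin 2) :=
  !₂[a * cos θ - h * sin θ, a * sin θ + h * cos θ]

theorem dist_framePoint (θ a h a' h' : ℝ) :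
    dist (framePoint θ a h) (framePoint θ a' h') = √((a - a') ^ 2 + (h - h') ^ 2) := by
  rw [EuclideanSpace.dist_eq, Fin.sum_univ_two, Real.dist_eq, Real.dist_eq, sq_abs, sq_abs]
  congr 1
  simp only [framePoint, PiLp.toLp_apply, Matrix.cons_val_zero, Matrix.cons_val_one]
  linear_combination ((a - a') ^ 2 + (h - h') ^ 2) * sin_sq_add_cos_sq θ

theorem norm_framePoint (θ a h : ℝ) : ‖framePoint θ a h‖ = √(a ^ 2 + h ^ 2) := by
  have h0 : framePoint θ 0 0 = 0 := by
    ext i; fin_cases i <;> simp [framePoint]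
  have := dist_framePoint θ a h 0 0
  rwa [h0, dist_zero_right, sub_zero, sub_zero] at this

theorem abs_le_norm_framePoint_left (θ a h : ℝ) : |a| ≤ ‖framePoint θ a h‖ := by
  rw [norm_framePoint]
  exact Real.abs_le_sqrt (by nlinarith [sq_nonneg h])

theorem abs_le_norm_framePoint_right (θ a h : ℝ) : |h| ≤ ‖framePoint θ a h‖ := by
  rw [norm_framePoint]
  exact Real.abs_le_sqrt (by nlinarith [sq_nonneg a])

theorem norm_framePoint_le (θ a h : ℝ) : ‖framePoint θ a h‖ ≤ |a| + |h| := by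
  rw [norm_framePoint]
  refine Real.sqrt_le_iff.2 ⟨by positivity, ?_⟩
  nlinarith [sq_abs a, sq_abs h, mul_nonneg (abs_nonneg a) (abs_nonneg h)]

theorem exists_eq_framePoint (θ : ℝ) (x : EuclideanSpace ℝ (Fin 2)) :
    ∃ a h, x = framePoint θ a h := by
  refine ⟨x 0 * cos θ + x 1 * sin θ, x 1 * cos θ - x 0 * sin θ, ?_⟩
  have := sin_sq_add_cos_sq θ
  ext i
  fin_cases i
  · simp only [framePoint, PiLp.toLp_apply, Fin.zero_eta, Matrix.cons_val_zero]
    linear_combination (-x 0) * this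
  · simp only [framePoint, PiLp.toLp_apply, Fin.mk_one, Matrix.cons_val_one,
      Matrix.cons_val_fin_one]
    linear_combination (-x 1) * this

theorem framePoint_add_smul (θ a h t b c : ℝ) :
    framePoint θ a h + t • framePoint θ b c = framePoint θ (a + t * b) (h + t * c) := by
  ext i
  fin_cases i <;> simp [framePoint] <;> ring

theorem framePoint_one_zero (θ α : ℝ) :
    framePoint (θ + α) 1 0 = framePoint θ (cos α) (sin α) := by
  ext i
  fin_cases i <;> simp [framePoint, cos_add, sin_add] <;> ring

theorem framePoint_add_two_pi_mul (θ a h : ℝ) (m : ℕ) :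
    framePoint (θ + m * (2 * π)) a h = framePoint θ a h := by
  simp [framePoint, cos_add_nat_mul_two_pi, sin_add_nat_mul_two_pi]

theorem exists_eq_framePoint_of_mem_sphere {v : EuclideanSpace ℝ (Fin 2)}
    (hv : v ∈ sphere (0 : EuclideanSpace ℝ (Fin 2)) 1) : ∃ φ, 0 ≤ φ ∧ v = framePoint φ 1 0 := by
  let z : ℂ := ⟨v 0, v 1⟩
  have hz : ‖z‖ = 1 := by
    rw [mem_sphere_zero_iff_norm, EuclideanSpace.norm_eq, Fin.sum_univ_two] at hv
    rw [← hv, Complex.norm_def, Complex.normSq_apply]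
    simp [z, pow_two]
  have h0 := Complex.norm_mul_cos_arg z
  have h1 := Complex.norm_mul_sin_arg z
  rw [hz, one_mul] at h0 h1
  refine ⟨z.arg + (1 : ℕ) * (2 * π), ?_, ?_⟩
  · push_cast
    linarith [Complex.neg_pi_lt_arg z, Real.pi_pos]
  · rw [framePoint_add_two_pi_mul]
    ext i
    fin_cases i
    · simp [framePoint, h0, z]
    · simp [framePoint, h1, z]

/-- The logarithm of the scale index, shifted so as to be at least `1`. -/
noncomputable def scaleLog (k : ℕ) : ℝ := log (k + 3)

/-- The direction in which the `k`-th block of obstacles is placed. -/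
noncomputable def blockAngle (k : ℕ) : ℝ := log (scaleLog k)

/-- The number of parallel rows in the `k`-th block of obstacles. -/
noncomputable def blockRows (k : ℕ) : ℕ := ⌈√(scaleLog k)⌉₊

/-- The distance from the origin to the `k`-th block of obstacles. -/
noncomputable def blockRadius (k : ℕ) : ℝ := 4 ^ (k + 3)

/-- Half the number of points in a row of the `k`-th block of obstacles. -/
noncomputable def blockWidth (k : ℕ) : ℕ :=
  ⌈blockRows k + 1 + 4 * (blockRadius k / ((k + 3) * scaleLog k))⌉₊

theorem one_le_scaleLog (k : ℕ) : 1 ≤ scaleLog k := by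
  rw [scaleLog, Real.le_log_iff_exp_le (by positivity)]
  have : (0 : ℝ) ≤ k := k.cast_nonneg
  linarith [Real.exp_one_lt_three]

theorem scaleLog_le (k : ℕ) : scaleLog k ≤ k + 3 := Real.log_le_self (by positivity)

theorem log_sub_log_le {a b : ℝ} (ha : 0 < a) (hb : 0 < b) : log b - log a ≤ (b - a) / a := by
  rw [← Real.log_div hb.ne' ha.ne', sub_div, div_self ha.ne']
  exact Real.log_le_sub_one_of_pos (by positivity)

theorem scaleLog_succ_sub_le (k : ℕ) : scaleLog (k + 1) - scaleLog k ≤ 1 / (k + 3) := by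
  have h := log_sub_log_le (a := k + 3) (b := (k + 1 : ℕ) + 3) (by positivity) (by positivity)
  refine h.trans_eq ?_
  push_cast
  ring

theorem scaleLog_mono : Monotone scaleLog := by
  intro i j hij
  have : (i : ℝ) ≤ j := by exact_mod_cast hij
  exact Real.log_le_log (by positivity) (by linarith)

theorem tendsto_scaleLog : Tendsto scaleLog atTop atTop :=
  Real.tendsto_log_atTop.comp (tendsto_atTop_add_const_right _ _ tendsto_natCast_atTop_atTop)

theorem tendsto_blockAngle : Tendsto blockAngle atTop atTop :=
  Real.tendsto_log_atTop.comp tendsto_scaleLog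

theorem tendsto_sqrt_scaleLog : Tendsto (fun k => √(scaleLog k)) atTop atTop :=
  Real.tendsto_sqrt_atTop.comp tendsto_scaleLog

theorem blockAngle_mono : Monotone blockAngle := by
  intro i j hij
  exact Real.log_le_log (by linarith [one_le_scaleLog i]) (scaleLog_mono hij)

theorem blockAngle_succ_sub_le (k : ℕ) :
    blockAngle (k + 1) - blockAngle k ≤ 1 / ((k + 3) * scaleLog k) := by
  have h1 := one_le_scaleLog k
  have h := log_sub_log_le (a := scaleLog k) (b := scaleLog (k + 1)) (by linarith)
    (by linarith [one_le_scaleLog (k + 1)])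
  calc _ ≤ _ := h
    _ ≤ 1 / (k + 3) / scaleLog k := by
        have := scaleLog_succ_sub_le k
        gcongr
    _ = _ := by rw [div_div]

theorem one_le_sqrt_scaleLog (k : ℕ) : 1 ≤ √(scaleLog k) :=
  Real.one_le_sqrt.2 (one_le_scaleLog k)

theorem sqrt_scaleLog_le_blockRows (k : ℕ) : √(scaleLog k) ≤ blockRows k := Nat.le_ceil _

theorem blockRows_le (k : ℕ) : (blockRows k : ℝ) ≤ 2 * √(scaleLog k) := by
  have := Nat.ceil_lt_add_one (Real.sqrt_nonneg (scaleLog k))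
  rw [blockRows]
  linarith [one_le_sqrt_scaleLog k]

theorem blockRows_pos (k : ℕ) : 0 < blockRows k := by
  have h := (one_le_sqrt_scaleLog k).trans (sqrt_scaleLog_le_blockRows k)
  have : (0 : ℝ) < blockRows k := by linarith
  exact_mod_cast this

theorem sqrt_scaleLog_le (k : ℕ) : √(scaleLog k) ≤ scaleLog k := by
  nlinarith [one_le_sqrt_scaleLog k, Real.sq_sqrt (zero_le_one.trans (one_le_scaleLog k))]

theorem blockRadius_succ (k : ℕ) : blockRadius (k + 1) = 4 * blockRadius k := by
  simp only [blockRadius]; ring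

theorem cube_le_blockRadius (k : ℕ) : ((k : ℝ) + 3) ^ 3 ≤ blockRadius k := by
  induction k with
  | zero => norm_num [blockRadius]
  | succ k ih =>
    have : (0 : ℝ) ≤ k := k.cast_nonneg
    rw [blockRadius_succ]
    push_cast
    nlinarith [mul_nonneg this this, mul_nonneg (mul_nonneg this this) this]

theorem blockRadius_pos (k : ℕ) : 0 < blockRadius k := by unfold blockRadius; positivity

theorem blockRadius_mono : Monotone blockRadius := fun i j hij =>
  pow_le_pow_right₀ (by norm_num) (by omega)

theorem nine_mul_le_blockRadius (k : ℕ) : 9 * ((k : ℝ) + 3) ≤ blockRadius k := by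
  have : (0 : ℝ) ≤ k := k.cast_nonneg
  nlinarith [cube_le_blockRadius k, mul_nonneg this this, mul_nonneg (mul_nonneg this this) this]

theorem blockRows_le_two_mul (k : ℕ) : (blockRows k : ℝ) ≤ 2 * (k + 3) := by
  linarith [blockRows_le k, sqrt_scaleLog_le k, scaleLog_le k]

theorem le_blockWidth (k : ℕ) :
    blockRows k + 1 + 4 * (blockRadius k / ((k + 3) * scaleLog k)) ≤ blockWidth k :=
  Nat.le_ceil _

theorem blockWidth_le (k : ℕ) :
    (blockWidth k : ℝ) ≤ blockRows k + 2 + 4 * (blockRadius k / ((k + 3) * scaleLog k)) := by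
  have h1 := one_le_scaleLog k
  have h2 := blockRadius_pos k
  have := Nat.ceil_lt_add_one (a := blockRows k + 1 + 4 * (blockRadius k / ((k + 3) * scaleLog k)))
    (by positivity)
  rw [blockWidth]
  linarith

theorem blockRadius_add_le (k : ℕ) :
    blockRadius k + blockRows k + (blockWidth k + 1) ≤ blockRadius (k + 1) - 1 := by
  have h1 := one_le_scaleLog k
  have h2 := blockRadius_pos k
  have h3 : (0 : ℝ) ≤ k := k.cast_nonneg
  have h4 : blockRadius k / ((k + 3) * scaleLog k) ≤ blockRadius k / 3 := by
    gcongr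
    nlinarith
  rw [blockRadius_succ]
  linarith [blockWidth_le k, blockRows_le_two_mul k, nine_mul_le_blockRadius k]

/-- A bound, up to a constant, for the number of points in the first `k` blocks. -/
noncomputable def blockBound (k : ℕ) : ℝ := blockRadius k / ((k + 3) * √(scaleLog k))

theorem blockRows_mul_blockWidth_le (k : ℕ) :
    (blockRows k : ℝ) * (2 * blockWidth k + 1) ≤ 34 * blockBound k := by
  have h1 := one_le_scaleLog k
  have h2 := blockRadius_pos k
  have h3 : (0 : ℝ) ≤ k := k.cast_nonneg
  have h4 := one_le_sqrt_scaleLog k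
  have h5 := Real.sq_sqrt (zero_le_one.trans h1)
  have h6 := scaleLog_le k
  have h7 : scaleLog k ≤ blockBound k := by
    rw [blockBound, le_div_iff₀ (by positivity)]
    calc scaleLog k * ((k + 3) * √(scaleLog k)) ≤ (k + 3) * ((k + 3) * (k + 3)) := by
          gcongr
          exact (sqrt_scaleLog_le k).trans h6
      _ = ((k : ℝ) + 3) ^ 3 := by ring
      _ ≤ _ := cube_le_blockRadius k
  have h8 : √(scaleLog k) * (blockRadius k / ((k + 3) * scaleLog k)) = blockBound k := by
    rw [blockBound]
    nth_rewrite 2 [← h5]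
    field_simp
  calc (blockRows k : ℝ) * (2 * blockWidth k + 1)
      ≤ 2 * √(scaleLog k) *
        (2 * (2 * √(scaleLog k) + 2 + 4 * (blockRadius k / ((k + 3) * scaleLog k))) + 1) := by
        gcongr
        · exact blockRows_le k
        · linarith [blockWidth_le k, blockRows_le k]
    _ = 8 * √(scaleLog k) ^ 2 + 10 * √(scaleLog k) +
        16 * (√(scaleLog k) * (blockRadius k / ((k + 3) * scaleLog k))) := by ring
    _ ≤ 34 * blockBound k := by
        rw [h5, h8]
        linarith [sqrt_scaleLog_le k]

theorem two_mul_blockBound_le (k : ℕ) : 2 * blockBound k ≤ blockBound (k + 1) := by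
  have h1 := one_le_scaleLog k
  have h2 := blockRadius_pos k
  have h3 : (0 : ℝ) ≤ k := k.cast_nonneg
  have h4 := one_le_sqrt_scaleLog k
  have h5 := one_le_sqrt_scaleLog (k + 1)
  have h6 : √(scaleLog (k + 1)) ≤ 4 / 3 * √(scaleLog k) := by
    refine Real.sqrt_le_iff.2 ⟨by positivity, ?_⟩
    rw [mul_pow, Real.sq_sqrt (by linarith)]
    have : (1 : ℝ) / (k + 3) ≤ 1 / 3 := by gcongr; linarith
    linarith [scaleLog_succ_sub_le k]
  rw [blockBound, blockBound, blockRadius_succ, mul_div_assoc', div_le_div_iff₀ (by positivity)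
    (by positivity)]
  push_cast
  have h7 : ((k : ℝ) + 1 + 3) * √(scaleLog (k + 1)) ≤
      4 / 3 * ((k : ℝ) + 3) * (4 / 3 * √(scaleLog k)) := by
    gcongr
    linarith
  have h8 : 0 ≤ ((k : ℝ) + 3) * √(scaleLog k) := by positivity
  nlinarith

/-- The `i`-th, `j`-th obstacle of the `k`-th block. -/
noncomputable def obstacle (k : ℕ) (q : ℕ × ℤ) : EuclideanSpace ℝ (Fin 2) :=
  framePoint (blockAngle k) (blockRadius k + q.1) (q.2 + q.1 / blockRows k)

/-- The index set of the `k`-th block. -/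
noncomputable def blockIndex (k : ℕ) : Finset (ℕ × ℤ) :=
  Finset.range (blockRows k) ×ˢ Finset.Icc (-(blockWidth k : ℤ)) (blockWidth k)

/-- The set of all obstacles. -/
def obstacles : Set (EuclideanSpace ℝ (Fin 2)) :=
  {p | ∃ k, ∃ q ∈ blockIndex k, p = obstacle k q}

theorem mem_blockIndex {k : ℕ} {q : ℕ × ℤ} :
    q ∈ blockIndex k ↔ q.1 < blockRows k ∧ |q.2| ≤ blockWidth k := by
  rw [blockIndex, Finset.mem_product, Finset.mem_range, Finset.mem_Icc, abs_le]

theorem card_blockIndex (k : ℕ) :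
    ((blockIndex k).card : ℝ) = blockRows k * (2 * blockWidth k + 1) := by
  rw [blockIndex, Finset.card_product, Finset.card_range, Int.card_Icc]
  have : ((blockWidth k : ℤ) + 1 - -(blockWidth k : ℤ)).toNat = 2 * blockWidth k + 1 := by omega
  rw [this]
  push_cast
  ring

theorem blockRadius_le_norm_obstacle (k : ℕ) (q : ℕ × ℤ) : blockRadius k ≤ ‖obstacle k q‖ := by
  refine le_trans ?_ (abs_le_norm_framePoint_left _ _ _)
  refine le_trans ?_ (le_abs_self _)
  linarith [q.1.cast_nonneg (α := ℝ)]

theorem norm_obstacle_le {k : ℕ} {q : ℕ × ℤ} (hq : q ∈ blockIndex k) :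
    ‖obstacle k q‖ ≤ blockRadius (k + 1) - 1 := by
  rw [mem_blockIndex] at hq
  obtain ⟨h1, h2⟩ := hq
  have h1' : (q.1 : ℝ) < blockRows k := by exact_mod_cast h1
  have h2' : |(q.2 : ℝ)| ≤ blockWidth k := by exact_mod_cast h2
  have h3 : (q.1 : ℝ) / blockRows k ≤ 1 := div_le_one_of_le₀ h1'.le (Nat.cast_nonneg _)
  have h4 : (0 : ℝ) ≤ (q.1 : ℝ) / blockRows k := by positivity
  refine (norm_framePoint_le _ _ _).trans (le_trans ?_ (blockRadius_add_le k))
  have h5 : |blockRadius k + (q.1 : ℝ)| = blockRadius k + q.1 :=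
    abs_of_nonneg (add_nonneg (blockRadius_pos k).le (Nat.cast_nonneg _))
  have h6 := abs_add_le (q.2 : ℝ) ((q.1 : ℝ) / blockRows k)
  rw [abs_of_nonneg h4] at h6
  linarith

theorem one_le_dist_obstacle_of_lt {k l : ℕ} (hkl : k < l) {q q' : ℕ × ℤ}
    (hq : q ∈ blockIndex k) : 1 ≤ dist (obstacle k q) (obstacle l q') := by
  have h1 := norm_obstacle_le hq
  have h2 := blockRadius_le_norm_obstacle l q'
  have h3 := blockRadius_mono (Nat.succ_le_of_lt hkl)
  have h4 := norm_sub_norm_le (obstacle l q') (obstacle k q)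
  rw [Nat.succ_eq_add_one] at h3
  rw [dist_comm, dist_eq_norm]
  linarith

theorem one_le_dist_obstacle {k : ℕ} {q q' : ℕ × ℤ} (hne : q ≠ q') :
    1 ≤ dist (obstacle k q) (obstacle k q') := by
  rw [obstacle, obstacle, dist_framePoint, Real.one_le_sqrt]
  obtain ⟨i, j⟩ := q
  obtain ⟨i', j'⟩ := q'
  by_cases hi : i = i'
  · subst hi
    have hj : j - j' ≠ 0 := fun h => hne (by rw [sub_eq_zero.1 h])
    have h1 : (1 : ℝ) ≤ ((j - j' : ℤ) : ℝ) ^ 2 := by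
      exact_mod_cast Int.one_le_abs (pow_ne_zero 2 hj) |>.trans_eq (abs_of_nonneg (sq_nonneg _))
    push_cast at h1
    simpa using h1
  · have hi' : (i : ℤ) - i' ≠ 0 := by omega
    have h1 : (1 : ℝ) ≤ (((i : ℤ) - i' : ℤ) : ℝ) ^ 2 := by
      exact_mod_cast Int.one_le_abs (pow_ne_zero 2 hi') |>.trans_eq (abs_of_nonneg (sq_nonneg _))
    push_cast at h1
    have h2 : blockRadius k + i - (blockRadius k + i') = (i : ℝ) - i' := by ring
    simp only [h2]
    nlinarith [sq_nonneg ((j : ℝ) + i / blockRows k - (j' + i' / blockRows k))]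

theorem obstacles_separated : ∀ y₁ ∈ obstacles, ∀ y₂ ∈ obstacles, y₁ ≠ y₂ → 1 ≤ dist y₁ y₂ := by
  rintro _ ⟨k, q, hq, rfl⟩ _ ⟨l, q', hq', rfl⟩ hne
  rcases lt_trichotomy k l with h | h | h
  · exact one_le_dist_obstacle_of_lt h hq
  · subst h
    exact one_le_dist_obstacle fun h => hne (by rw [h])
  · rw [dist_comm]
    exact one_le_dist_obstacle_of_lt h hq'

open Classical in
theorem obstacles_inter_ball_subset {k : ℕ} {r : ℝ} (hr : r ≤ blockRadius (k + 1)) :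
    obstacles ∩ ball 0 r ⊆
      ((Finset.range (k + 1)).biUnion fun l => (blockIndex l).image (obstacle l) :
        Finset (EuclideanSpace ℝ (Fin 2))) := by
  rintro _ ⟨⟨l, q, hq, rfl⟩, hl⟩
  simp only [Finset.coe_biUnion, Set.mem_iUnion, Finset.coe_image]
  refine ⟨l, ?_, q, hq, rfl⟩
  rw [mem_ball_zero_iff] at hl
  rw [Finset.coe_range, Set.mem_Iio]
  by_contra! h
  linarith [blockRadius_le_norm_obstacle l q, blockRadius_mono h]

theorem sum_card_blockIndex_le (k : ℕ) :
    ∑ l ∈ Finset.range (k + 1), ((blockIndex l).card : ℝ) ≤ 68 * blockBound k := by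
  have h (k : ℕ) : ((blockIndex k).card : ℝ) ≤ 34 * blockBound k :=
    (card_blockIndex k).trans_le (blockRows_mul_blockWidth_le k)
  induction k with
  | zero =>
    rw [zero_add, Finset.sum_range_one]
    linarith [h 0, (Nat.cast_nonneg (blockIndex 0).card : (0 : ℝ) ≤ _)]
  | succ k ih =>
    rw [Finset.sum_range_succ]
    linarith [h (k + 1), two_mul_blockBound_le k]

theorem ncard_obstacles_inter_ball_le {k : ℕ} {r : ℝ} (hr : r ≤ blockRadius (k + 1)) :
    ((obstacles ∩ ball 0 r).ncard : ℝ) ≤ 68 * blockBound k := by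
  classical
  refine le_trans ?_ (sum_card_blockIndex_le k)
  have h1 := Set.ncard_le_ncard (obstacles_inter_ball_subset hr) (Finset.finite_toSet _)
  rw [Set.ncard_coe_finset] at h1
  exact_mod_cast h1.trans (Finset.card_biUnion_le.trans
    (Finset.sum_le_sum fun l _ => Finset.card_image_le))

theorem exists_blockRadius_near {K : ℕ} {r : ℝ} (hr : blockRadius K ≤ r) :
    ∃ k ≥ K, blockRadius k ≤ r ∧ r < blockRadius (k + 1) := by
  have h1 : 1 ≤ r / blockRadius K := (one_le_div (blockRadius_pos K)).2 hr
  obtain ⟨n, h2, h3⟩ := exists_nat_pow_near h1 (by norm_num : (1 : ℝ) < 4)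
  rw [le_div_iff₀ (blockRadius_pos K)] at h2
  rw [div_lt_iff₀ (blockRadius_pos K)] at h3
  refine ⟨K + n, by omega, ?_, ?_⟩
  · refine le_trans (le_of_eq ?_) h2
    simp only [blockRadius]; ring
  · refine h3.trans_eq ?_
    simp only [blockRadius]; ring

theorem finite_obstacles_inter_ball (r : ℝ) : (obstacles ∩ ball 0 r).Finite := by
  obtain ⟨k, -, -, hk⟩ := exists_blockRadius_near (le_max_right r (blockRadius 0))
  exact (Finset.finite_toSet _).subset
    (obstacles_inter_ball_subset ((le_max_left _ _).trans hk.le))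

theorem tendsto_ncard_obstacles :
    Tendsto (fun r : ℝ => ((obstacles ∩ ball 0 r).ncard : ℝ) * log r / r) atTop (nhds 0) := by
  have hlim : Tendsto (fun k => 68 * (2 * log 4) / √(scaleLog k)) atTop (nhds 0) :=
    tendsto_const_nhds.div_atTop tendsto_sqrt_scaleLog
  rw [Metric.tendsto_atTop]
  intro ε hε
  obtain ⟨K, hK⟩ := eventually_atTop.1 (hlim.eventually (gt_mem_nhds hε))
  refine ⟨blockRadius K, fun r hr => ?_⟩
  obtain ⟨k, hkK, hk1, hk2⟩ := exists_blockRadius_near hr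
  have hpos := blockRadius_pos k
  have h1 : 1 ≤ blockRadius k := one_le_pow₀ (by norm_num)
  have hlog : 0 ≤ log r := Real.log_nonneg (h1.trans hk1)
  have hr0 : 0 < r := hpos.trans_le hk1
  have hlog' : log r ≤ (k + 4) * log 4 := by
    refine (Real.log_le_log hr0 hk2.le).trans_eq ?_
    rw [blockRadius, Real.log_pow]
    push_cast
    ring
  have hs := one_le_sqrt_scaleLog k
  have h4 : (0 : ℝ) < log 4 := Real.log_pos (by norm_num)
  rw [Real.dist_eq, sub_zero, abs_of_nonneg (by positivity)]
  refine lt_of_le_of_lt ?_ (hK k hkK)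
  have hb : (0 : ℝ) ≤ blockBound k := by unfold blockBound; positivity
  calc ((obstacles ∩ ball 0 r).ncard : ℝ) * log r / r
      ≤ 68 * blockBound k * ((k + 4) * log 4) / blockRadius k := by
        gcongr
        exact ncard_obstacles_inter_ball_le hk2.le
    _ = 68 * ((k + 4) * log 4 / (k + 3)) / √(scaleLog k) := by
        rw [blockBound]
        field_simp
    _ ≤ 68 * (2 * log 4) / √(scaleLog k) := by
        gcongr
        rw [div_le_iff₀ (by positivity)]
        nlinarith [(Nat.cast_nonneg k : (0 : ℝ) ≤ k)]

theorem half_le_cos {α : ℝ} (h0 : 0 ≤ α) (h1 : α ≤ 1) : 1 / 2 ≤ cos α := by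
  have := Real.one_sub_sq_div_two_le_cos (x := α)
  nlinarith

/-- A ray that starts near the origin and whose direction lies in the sector of the `k`-th block
passes close to one of its obstacles. -/
theorem exists_obstacle_near {k : ℕ} {x : EuclideanSpace ℝ (Fin 2)} (hx : ‖x‖ ≤ blockRows k)
    {φ : ℝ} (h1 : blockAngle k ≤ φ) (h2 : φ ≤ blockAngle (k + 1)) :
    ∃ q ∈ blockIndex k, ∃ p ∈ ray x (framePoint φ 1 0),
      dist p (obstacle k q) ≤ 5 / √(scaleLog k) := by
  obtain ⟨α, rfl⟩ : ∃ α, φ = blockAngle k + α := ⟨φ - blockAngle k, by ring⟩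
  obtain ⟨a, b, rfl⟩ := exists_eq_framePoint (blockAngle k) x
  have ha := (abs_le_norm_framePoint_left _ _ _).trans hx
  have hb := (abs_le_norm_framePoint_right _ _ _).trans hx
  set N := blockRows k with hN
  set s := blockRadius k with hs
  have hl := one_le_scaleLog k
  have hk : (0 : ℝ) ≤ k := k.cast_nonneg
  have hα0 : 0 ≤ α := by linarith
  have hα : α ≤ 1 / ((k + 3) * scaleLog k) := by linarith [blockAngle_succ_sub_le k]
  have hα1 : α ≤ 1 := by
    refine hα.trans ((div_le_one (by positivity)).2 ?_)
    nlinarith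
  have hcos := half_le_cos hα0 hα1
  have hcos0 : 0 < cos α := by linarith
  have htan : sin α / cos α ≤ 2 * α := by
    rw [div_le_iff₀ hcos0]
    nlinarith [Real.sin_le hα0]
  have htan0 : 0 ≤ sin α / cos α :=
    div_nonneg (Real.sin_nonneg_of_nonneg_of_le_pi hα0 (by linarith [Real.pi_gt_three])) hcos0.le
  set T := sin α / cos α with hT
  have hNpos : (0 : ℝ) < N := by exact_mod_cast blockRows_pos k
  have hNs : (N : ℝ) ≤ s := by
    linarith [blockRows_le_two_mul k, nine_mul_le_blockRadius k]
  set h := b + (s - a) * T with hh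
  set j := ⌊h⌋ with hj
  set i := ⌊N * Int.fract h⌋₊ with hi
  have hfr0 := Int.fract_nonneg h
  have hfr1 := Int.fract_lt_one h
  have hi1 : (i : ℝ) ≤ N * Int.fract h := Nat.floor_le (by positivity)
  have hi2 : N * Int.fract h < i + 1 := Nat.lt_floor_add_one _
  have hiN : (i : ℝ) < N := by nlinarith
  have hjh : h = j + Int.fract h := (Int.floor_add_fract h).symm
  obtain ⟨ha1, ha2⟩ := abs_le.1 ha
  have hhabs : |h| ≤ N + 4 * (s / ((k + 3) * scaleLog k)) := by
    calc |h| ≤ |b| + |(s - a) * T| := abs_add_le _ _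
      _ = |b| + (s - a) * T := by rw [abs_of_nonneg (mul_nonneg (by linarith) htan0)]
      _ ≤ N + (2 * s) * (2 * (1 / ((k + 3) * scaleLog k))) := by
          gcongr
          · linarith
          · linarith
          · linarith
      _ = _ := by ring
  refine ⟨(i, j), mem_blockIndex.2 ⟨by exact_mod_cast hiN, ?_⟩, ?_⟩
  · have := le_blockWidth k
    obtain ⟨hh1, hh2⟩ := abs_le.1 hhabs
    have : |(j : ℝ)| ≤ blockWidth k := abs_le.2 ⟨by linarith, by linarith⟩
    exact_mod_cast this
  · refine ⟨_, ⟨(s + i - a) / cos α, ?_, rfl⟩, ?_⟩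
    · exact div_nonneg (by linarith [(Nat.cast_nonneg i : (0 : ℝ) ≤ i)]) hcos0.le
    · rw [framePoint_one_zero, framePoint_add_smul, obstacle, dist_framePoint,
        div_mul_cancel₀ _ hcos0.ne']
      have e1 : a + (s + i - a) - (s + (i : ℝ)) = 0 := by ring
      have e2 : b + (s + i - a) / cos α * sin α - (j + i / N) =
          i * T + (Int.fract h - i / N) := by
        have : b + (s + i - a) / cos α * sin α = h + i * T := by
          rw [hh, hT]; field_simp; ring
        rw [this, hjh]; simp only [Int.fract_intCast_add, Int.fract_fract]; ring
      simp only [← hs, ← hN]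
      rw [e1, e2, zero_pow two_ne_zero, zero_add, Real.sqrt_sq_eq_abs]
      have f1 : (i : ℝ) / N ≤ Int.fract h := by
        rw [div_le_iff₀ hNpos]; linarith
      have f2 : Int.fract h - i / N ≤ 1 / N := by
        rw [sub_le_iff_le_add, ← add_div, le_div_iff₀ hNpos]; linarith
      rw [abs_of_nonneg (add_nonneg (by positivity) (by linarith))]
      have hsq := one_le_sqrt_scaleLog k
      have f3 : 1 / (N : ℝ) ≤ 1 / √(scaleLog k) := by
        gcongr
        exact sqrt_scaleLog_le_blockRows k
      have f4 : (i : ℝ) * T ≤ 4 / √(scaleLog k) := by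
        calc (i : ℝ) * T ≤ 2 * √(scaleLog k) * (2 * (1 / ((k + 3) * scaleLog k))) := by
              gcongr
              · linarith [blockRows_le k]
              · linarith
          _ ≤ 2 * √(scaleLog k) * (2 * (1 / (1 * scaleLog k))) := by
              gcongr
              linarith
          _ = 4 / √(scaleLog k) := by
              nth_rewrite 2 [← Real.sq_sqrt (zero_le_one.trans hl)]
              field_simp
              norm_num
      calc _ ≤ 4 / √(scaleLog k) + 1 / √(scaleLog k) := by linarith
        _ = _ := by ring

theorem exists_blockAngle_near {φ : ℝ} (hφ : 0 ≤ φ) (K : ℕ) :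
    ∃ k ≥ K, ∃ m : ℕ, blockAngle k ≤ φ + m * (2 * π) ∧
      φ + m * (2 * π) ≤ blockAngle (k + 1) := by
  obtain ⟨m, hm⟩ := exists_nat_ge (blockAngle K / (2 * π))
  rw [div_le_iff₀ (by positivity)] at hm
  have hex : ∃ n, φ + m * (2 * π) < blockAngle n :=
    (tendsto_blockAngle.eventually_gt_atTop _).exists
  classical
  have hlt := Nat.find_spec hex
  have hK : K < Nat.find hex := by
    by_contra! h
    linarith [blockAngle_mono h]
  refine ⟨Nat.find hex - 1, by omega, m, ?_, ?_⟩
  · exact not_lt.1 (Nat.find_min hex (by omega))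
  · rw [Nat.sub_add_cancel (by omega)]
    exact hlt.le

theorem exists_obstacles_near_ray {x v : EuclideanSpace ℝ (Fin 2)}
    (hv : v ∈ sphere (0 : EuclideanSpace ℝ (Fin 2)) 1) {ε : ℝ} (hε : 0 < ε) :
    ∃ y ∈ obstacles, y ≠ x ∧ ∃ p ∈ ray x v, dist p y < ε := by
  obtain ⟨φ, hφ, rfl⟩ := exists_eq_framePoint_of_mem_sphere hv
  have hlim : Tendsto (fun k => 5 / √(scaleLog k)) atTop (nhds 0) :=
    tendsto_const_nhds.div_atTop tendsto_sqrt_scaleLog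
  obtain ⟨K, hK⟩ := eventually_atTop.1
    ((hlim.eventually (gt_mem_nhds hε)).and (tendsto_sqrt_scaleLog.eventually_ge_atTop ‖x‖))
  obtain ⟨k, hk, m, h1, h2⟩ := exists_blockAngle_near hφ K
  obtain ⟨hk1, hk2⟩ := hK k hk
  have hx := hk2.trans (sqrt_scaleLog_le_blockRows k)
  obtain ⟨q, hq, p, hp, hd⟩ := exists_obstacle_near hx h1 h2
  rw [framePoint_add_two_pi_mul] at hp
  refine ⟨obstacle k q, ⟨k, q, hq, rfl⟩, ?_, p, hp, hd.trans_lt hk1⟩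
  rintro rfl
  linarith [blockRadius_le_norm_obstacle k q, blockRows_le_two_mul k, nine_mul_le_blockRadius k,
    (Nat.cast_nonneg k : (0 : ℝ) ≤ k)]

theorem setDist_ray_obstacles_le {Y : Set (EuclideanSpace ℝ (Fin 2))} (hY : obstacles ⊆ Y)
    {x v : EuclideanSpace ℝ (Fin 2)} (hv : v ∈ sphere (0 : EuclideanSpace ℝ (Fin 2)) 1) :
    setDist (ray x v) (Y \ {x}) ≤ 0 := by
  refine le_of_forall_pos_le_add fun ε hε => ?_
  obtain ⟨y, hy, hne, p, hp, hd⟩ := exists_obstacles_near_ray (x := x) hv hε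
  have hmem : dist p y ∈ Set.image2 dist (ray x v) (Y \ {x}) :=
    Set.mem_image2_of_mem hp ⟨hY hy, hne⟩
  rw [zero_add]
  refine (csInf_le ⟨0, ?_⟩ hmem).trans hd.le
  rintro _ ⟨_, _, _, _, rfl⟩
  exact dist_nonneg

theorem div_log_le_div_log {a b : ℝ} (ha : exp 1 ≤ a) (hab : a ≤ b) :
    a / log a ≤ b / log b := by
  have ha0 : 0 < a := (exp_pos 1).trans_le ha
  have hla : 1 ≤ log a := (Real.le_log_iff_exp_le ha0).2 ha
  have hlb : 1 ≤ log b := hla.trans (Real.log_le_log ha0 hab)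
  rw [div_le_div_iff₀ (by linarith) (by linarith)]
  have h := log_sub_log_le ha0 (ha0.trans_le hab)
  rw [le_div_iff₀ ha0] at h
  nlinarith

theorem div_log_sub_div_log_le {a b : ℝ} (ha : exp 1 ≤ a) (hab : a ≤ b) :
    b / log b - a / log a ≤ b - a := by
  have ha0 : 0 < a := (exp_pos 1).trans_le ha
  have hla : 1 ≤ log a := (Real.le_log_iff_exp_le ha0).2 ha
  have hlab := Real.log_le_log ha0 hab
  have h1 : a / log b ≤ a / log a := by gcongr
  have h2 : (b - a) / log b ≤ b - a := div_le_self (by linarith) (by linarith)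
  rw [sub_div] at h2
  linarith

theorem tendsto_log_div_self : Tendsto (fun x : ℝ => log x / x) atTop (nhds 0) :=
  Real.isLittleO_log_id_atTop.tendsto_div_nhds_zero

theorem exists_div_log_eq (n : ℕ) : ∃ x : ℝ, exp 1 ≤ x ∧ x / log x = n + 3 := by
  have hn : (0 : ℝ) ≤ n := n.cast_nonneg
  have hev : ∀ᶠ x : ℝ in atTop, log x / x < 1 / (n + 3) :=
    tendsto_log_div_self.eventually (gt_mem_nhds (by positivity))
  obtain ⟨X, hX, hX1⟩ := (hev.and (eventually_ge_atTop (exp 1))).exists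
  have hX0 : 0 < X := (exp_pos 1).trans_le hX1
  have hlX : 1 ≤ log X := (Real.le_log_iff_exp_le hX0).2 hX1
  have hcont : ContinuousOn (fun x : ℝ => x / log x) (Set.Icc (exp 1) X) := by
    intro x hx
    have hx0 : 0 < x := (exp_pos 1).trans_le hx.1
    have hlx : 1 ≤ log x := (Real.le_log_iff_exp_le hx0).2 hx.1
    exact (continuousAt_id.div (Real.continuousAt_log hx0.ne') (by linarith)).continuousWithinAt
  have hmem : (n : ℝ) + 3 ∈ Set.Icc (exp 1 / log (exp 1)) (X / log X) := by
    constructor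
    · rw [Real.log_exp, div_one]
      linarith [Real.exp_one_lt_three]
    · rw [div_lt_div_iff₀ hX0 (by positivity)] at hX
      rw [le_div_iff₀ (by linarith)]
      linarith
  obtain ⟨x, hx, hxn⟩ := intermediate_value_Icc hX1 hcont hmem
  exact ⟨x, hx.1, hxn⟩

/-- The solution `x ≥ e` of `x / log x = n + 3`. -/
noncomputable def fillerAbscissa (n : ℕ) : ℝ := (exists_div_log_eq n).choose

theorem exp_one_le_fillerAbscissa (n : ℕ) : exp 1 ≤ fillerAbscissa n :=
  (exists_div_log_eq n).choose_spec.1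

theorem fillerAbscissa_div_log (n : ℕ) : fillerAbscissa n / log (fillerAbscissa n) = n + 3 :=
  (exists_div_log_eq n).choose_spec.2

/-- Points on the first coordinate axis whose counting function is asymptotic to `r / log r`. -/
noncomputable def filler (n : ℕ) : EuclideanSpace ℝ (Fin 2) := framePoint 0 (fillerAbscissa n) 0

theorem norm_filler (n : ℕ) : ‖filler n‖ = fillerAbscissa n := by
  rw [filler, norm_framePoint, zero_pow two_ne_zero, add_zero,
    Real.sqrt_sq ((exp_pos 1).le.trans (exp_one_le_fillerAbscissa n))]

theorem fillerAbscissa_add_le {m n : ℕ} (hmn : m < n) :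
    fillerAbscissa m + 1 ≤ fillerAbscissa n := by
  have hmn' : (m : ℝ) + 1 ≤ n := by exact_mod_cast hmn
  have hm := fillerAbscissa_div_log m
  have hn := fillerAbscissa_div_log n
  rcases le_total (fillerAbscissa m) (fillerAbscissa n) with h | h
  · linarith [div_log_sub_div_log_le (exp_one_le_fillerAbscissa m) h]
  · linarith [div_log_le_div_log (exp_one_le_fillerAbscissa n) h]

theorem one_le_dist_filler {m n : ℕ} (hmn : m ≠ n) : 1 ≤ dist (filler m) (filler n) := by
  wlog h : m < n generalizing m n
  · rw [dist_comm]
    exact this hmn.symm (by omega)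
  have h1 := norm_sub_norm_le (filler n) (filler m)
  rw [norm_filler, norm_filler] at h1
  rw [dist_comm, dist_eq_norm]
  linarith [fillerAbscissa_add_le h]

theorem filler_injective : Function.Injective filler := by
  intro m n h
  by_contra hne
  have := one_le_dist_filler hne
  rw [h, dist_self] at this
  linarith

theorem filler_mem_ball_of_lt {n : ℕ} {r : ℝ} (hr : exp 1 ≤ r) (hn : n + 3 < r / log r) :
    filler n ∈ ball (0 : EuclideanSpace ℝ (Fin 2)) r := by
  rw [mem_ball_zero_iff, norm_filler]
  by_contra! h
  linarith [div_log_le_div_log hr h, fillerAbscissa_div_log n]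

theorem lt_ceil_of_filler_mem_ball {n : ℕ} {r : ℝ}
    (hn : filler n ∈ ball (0 : EuclideanSpace ℝ (Fin 2)) r) : n < ⌈r / log r⌉₊ := by
  rw [mem_ball_zero_iff, norm_filler] at hn
  refine Nat.lt_ceil.2 ?_
  linarith [div_log_le_div_log (exp_one_le_fillerAbscissa n) hn.le, fillerAbscissa_div_log n]

/-- The filler points that are far from the obstacles. -/
def farFillers : Set (EuclideanSpace ℝ (Fin 2)) :=
  {p | p ∈ Set.range filler ∧ ∀ y ∈ obstacles, 1 / 2 ≤ dist p y}

theorem farFillers_inter_ball_subset (r : ℝ) :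
    farFillers ∩ ball 0 r ⊆ filler '' Finset.range ⌈r / log r⌉₊ := by
  rintro _ ⟨⟨⟨n, rfl⟩, -⟩, hn⟩
  exact ⟨n, Finset.mem_coe.2 (Finset.mem_range.2 (lt_ceil_of_filler_mem_ball hn)), rfl⟩

theorem ncard_farFillers_inter_ball_le (r : ℝ) :
    (farFillers ∩ ball 0 r).ncard ≤ ⌈r / log r⌉₊ := by
  refine (Set.ncard_le_ncard (farFillers_inter_ball_subset r)
    ((Finset.finite_toSet _).image _)).trans ?_
  rw [Set.ncard_image_of_injective _ filler_injective, Set.ncard_coe_finset, Finset.card_range]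

theorem ncard_union_inter_ball_le {r : ℝ} (hr : exp 1 ≤ r) :
    (((obstacles ∪ farFillers) ∩ ball 0 r).ncard : ℝ) ≤
      (obstacles ∩ ball 0 r).ncard + (r / log r + 1) := by
  have hr0 : 0 < r := (exp_pos 1).trans_le hr
  have hlr : 1 ≤ log r := (Real.le_log_iff_exp_le hr0).2 hr
  have h1 := Set.ncard_union_le (obstacles ∩ ball 0 r) (farFillers ∩ ball 0 r)
  rw [← Set.union_inter_distrib_right] at h1
  have h2 : (((obstacles ∪ farFillers) ∩ ball 0 r).ncard : ℝ) ≤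
      (obstacles ∩ ball 0 r).ncard + (⌈r / log r⌉₊ : ℕ) := by
    exact_mod_cast h1.trans (Nat.add_le_add_left (ncard_farFillers_inter_ball_le r) _)
  have h3 := Nat.ceil_lt_add_one (a := r / log r) (by positivity)
  linarith

theorem le_ncard_union_inter_ball {r : ℝ} (hr : exp 1 ≤ r) :
    r / log r - 4 ≤ (((obstacles ∪ farFillers) ∩ ball 0 r).ncard : ℝ) +
      (obstacles ∩ ball 0 (2 * r)).ncard := by
  have hr1 : 1 ≤ r := (Real.one_le_exp zero_le_one).trans hr
  set A := filler '' Finset.range ⌊r / log r - 3⌋₊ with hA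
  have hAcard : A.ncard = ⌊r / log r - 3⌋₊ := by
    rw [hA, Set.ncard_image_of_injective _ filler_injective, Set.ncard_coe_finset,
      Finset.card_range]
  have hAball : A ⊆ ball 0 r := by
    rintro _ ⟨n, hn, rfl⟩
    refine filler_mem_ball_of_lt hr ?_
    have h1 : n + 1 ≤ ⌊r / log r - 3⌋₊ :=
      Finset.mem_range.1 (Finset.mem_coe.1 hn)
    have h2 := (Nat.le_floor_iff' (by omega)).1 h1
    push_cast at h2
    linarith
  have hU : ((obstacles ∪ farFillers) ∩ ball 0 r).Finite := by
    rw [Set.union_inter_distrib_right]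
    exact (finite_obstacles_inter_ball r).union
      (((Finset.finite_toSet _).image _).subset (farFillers_inter_ball_subset r))
  have h1 : (A ∩ farFillers).ncard ≤ ((obstacles ∪ farFillers) ∩ ball 0 r).ncard :=
    Set.ncard_le_ncard (fun p hp => ⟨Or.inr hp.2, hAball hp.1⟩) hU
  have h2 : (A \ farFillers).ncard ≤ (obstacles ∩ ball 0 (2 * r)).ncard := by
    have hex : ∀ p ∈ A \ farFillers, ∃ y ∈ obstacles, dist p y < 1 / 2 := by
      rintro _ ⟨⟨n, hn, rfl⟩, hp⟩
      by_contra! h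
      exact hp ⟨⟨n, rfl⟩, h⟩
    choose! f hf hfd using hex
    refine Set.ncard_le_ncard_of_injOn f (fun p hp => ⟨hf p hp, ?_⟩) ?_
      (finite_obstacles_inter_ball _)
    · have h3 := hAball hp.1
      rw [mem_ball] at h3 ⊢
      have h4 := dist_triangle_left (f p) 0 p
      linarith [hfd p hp]
    · intro p hp q hq hpq
      have h3 := dist_triangle_right p q (f p)
      have h4 := hfd p hp
      have h5 := hfd q hq
      rw [← hpq] at h5
      obtain ⟨⟨m, -, rfl⟩, -⟩ := hp
      obtain ⟨⟨n, -, rfl⟩, -⟩ := hq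
      by_contra hne
      have := one_le_dist_filler (m := m) (n := n) fun h => hne (by rw [h])
      linarith
  have h3 := Set.ncard_inter_add_ncard_sdiff_eq_ncard A farFillers ((Finset.finite_toSet _).image _)
  have h4 := Nat.lt_floor_add_one (r / log r - 3)
  rw [hAcard] at h3
  have h5 : ((⌊r / log r - 3⌋₊ : ℕ) : ℝ) ≤ (((obstacles ∪ farFillers) ∩ ball 0 r).ncard : ℝ) +
      (obstacles ∩ ball 0 (2 * r)).ncard := by
    exact_mod_cast h3 ▸ Nat.add_le_add h1 h2
  linarith

theorem union_separated : ∀ y₁ ∈ obstacles ∪ farFillers, ∀ y₂ ∈ obstacles ∪ farFillers,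
    y₁ ≠ y₂ → 1 / 2 ≤ dist y₁ y₂ := by
  rintro y₁ (h₁ | h₁) y₂ (h₂ | h₂) hne
  · linarith [obstacles_separated y₁ h₁ y₂ h₂ hne]
  · rw [dist_comm]
    exact h₂.2 y₁ h₁
  · exact h₁.2 y₂ h₂
  · obtain ⟨⟨m, rfl⟩, -⟩ := h₁
    obtain ⟨⟨n, rfl⟩, -⟩ := h₂
    linarith [one_le_dist_filler (m := m) (n := n) fun h => hne (by rw [h])]

theorem tendsto_ncard_union :
    Tendsto (fun r : ℝ =>
      (((obstacles ∪ farFillers) ∩ ball 0 r).ncard : ℝ) * log r / r) atTop (nhds 1) := by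
  have hU : Tendsto (fun r : ℝ => ((obstacles ∩ ball 0 r).ncard : ℝ) * log r / r +
      (1 + log r / r)) atTop (nhds 1) := by
    simpa using tendsto_ncard_obstacles.add (tendsto_log_div_self.const_add 1)
  have h2 : Tendsto (fun r : ℝ => 2 * r) atTop atTop := tendsto_id.const_mul_atTop two_pos
  have hL : Tendsto (fun r : ℝ => 1 - 4 * (log r / r) -
      2 * (((obstacles ∩ ball 0 (2 * r)).ncard : ℝ) * log (2 * r) / (2 * r))) atTop (nhds 1) := by
    simpa using ((tendsto_log_div_self.const_mul 4).const_sub 1).sub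
      ((tendsto_ncard_obstacles.comp h2).const_mul 2)
  refine tendsto_of_tendsto_of_tendsto_of_le_of_le' hL hU ?_ ?_
  · filter_upwards [eventually_ge_atTop (exp 1)] with r hr
    have hr0 : 0 < r := (exp_pos 1).trans_le hr
    have hlr : 1 ≤ log r := (Real.le_log_iff_exp_le hr0).2 hr
    have h3 : log r ≤ log (2 * r) := Real.log_le_log hr0 (by linarith)
    have h4 : ((obstacles ∩ ball 0 (2 * r)).ncard : ℝ) * log r / r ≤
        2 * (((obstacles ∩ ball 0 (2 * r)).ncard : ℝ) * log (2 * r) / (2 * r)) := by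
      rw [mul_div_assoc', mul_div_mul_left _ _ two_ne_zero]
      gcongr
    have h5 : (r / log r - 4) * (log r / r) ≤ ((((obstacles ∪ farFillers) ∩ ball 0 r).ncard : ℝ) +
        (obstacles ∩ ball 0 (2 * r)).ncard) * (log r / r) := by
      gcongr
      exact le_ncard_union_inter_ball hr
    have h6 : (r / log r - 4) * (log r / r) = 1 - 4 * (log r / r) := by
      field_simp
    rw [h6, add_mul] at h5
    simp only [← mul_div_assoc] at h4 h5 ⊢
    linarith
  · filter_upwards [eventually_ge_atTop (exp 1)] with r hr
    have hr0 : 0 < r := (exp_pos 1).trans_le hr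
    have hlr : 1 ≤ log r := (Real.le_log_iff_exp_le hr0).2 hr
    have h5 : (((obstacles ∪ farFillers) ∩ ball 0 r).ncard : ℝ) * (log r / r) ≤
        ((obstacles ∩ ball 0 r).ncard + (r / log r + 1)) * (log r / r) := by
      gcongr
      exact ncard_union_inter_ball_le hr
    have h6 : (r / log r + 1) * (log r / r) = 1 + log r / r := by
      field_simp
    rwa [add_mul, h6, mul_div_assoc', mul_div_assoc'] at h5

theorem stmt5 : ∃ Y : Set (EuclideanSpace ℝ (Fin 2)),
    (∃ δ > (0 : ℝ), ∀ y₁ ∈ Y, ∀ y₂ ∈ Y, y₁ ≠ y₂ → δ ≤ dist y₁ y₂) ∧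
    (∀ x : EuclideanSpace ℝ (Fin 2),
      ¬ ∃ v ∈ sphere (0 : EuclideanSpace ℝ (Fin 2)) 1, 0 < setDist (ray x v) (Y \ {x})) ∧
    Tendsto (fun r : ℝ =>
        ((Y ∩ Metric.ball (0 : EuclideanSpace ℝ (Fin 2)) r).ncard : ℝ) * Real.log r / r)
      atTop (nhds 1) := by
  refine ⟨obstacles ∪ farFillers, ⟨1 / 2, by norm_num, union_separated⟩, ?_, tendsto_ncard_union⟩
  rintro x ⟨v, hv, h⟩
  exact h.not_ge (setDist_ray_obstacles_le Set.subset_union_left hv)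
end
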